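/- Let A be a C*-factor of von Neumann type I. Then there exists a cardinal number n such that A is a C*-algebra of type I_n, i.e. there exists a family {P_i}_{i∈Ξ} with |Ξ| = n of pairwise orthogonal Abelian annihilators, each with central support A, such that sup_i P_i = A in 𝒫. -/

import Mathlib

variable {A : Type*}

/-- The annihilator of a set `S`: elements anticommuting with every member of `S`. -/
def Ann [NonUnitalNonAssocRing A] (S : Set A) : Set A :=
  {a : A | ∀ s ∈ S, a * s + s * a = 0}

/-- `ᵈV = {a ∈ A : x a y + y a x = 0 for all x, y ∈ V}`. -/
def dAnn [NonUnitalNonAssocRing A] (V : Set A) : Set A :=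
  {a : A | ∀ x ∈ V, ∀ y ∈ V, x * a * y + y * a * x = 0}

/-- The set `𝒫` of annihilators of `A`. -/
def PAnn (A : Type*) [NonUnitalNonAssocRing A] [PartialOrder A] : Set (Set A) :=
  {V | ∃ S : Set A, (∀ s ∈ S, 0 ≤ s) ∧ V = Ann (Ann S)}

/-- A central annihilator of `A`. -/
def IsCentralAnn [NonUnitalNonAssocRing A] [PartialOrder A] (V : Set A) : Prop :=
  ∃ S : Set A, (∀ s ∈ S, 0 ≤ s) ∧ V = Ann (Ann S) ∧
    dAnn (Ann (Ann S)) ∩ dAnn (Ann S) = {0}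

/-- An Abelian annihilator: a commutative member of `𝒫`. -/
def IsAbelianAnn [NonUnitalNonAssocRing A] [PartialOrder A] (V : Set A) : Prop :=
  V ∈ PAnn A ∧ ∀ x ∈ V, ∀ y ∈ V, x * y = y * x

/-- `C` is the central support of `V`: the least central annihilator containing `V`. -/
def IsCentralSupport [NonUnitalNonAssocRing A] [PartialOrder A] (V C : Set A) : Prop :=
  IsCentralAnn C ∧ V ⊆ C ∧ ∀ W, IsCentralAnn W → V ⊆ W → C ⊆ W

/-- `A` is a C*-algebra of von Neumann type I: some Abelian annihilator has central support `A`. -/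
def VonNeumannTypeI (A : Type*) [NonUnitalNonAssocRing A] [PartialOrder A] : Prop :=
  ∃ V : Set A, IsAbelianAnn V ∧ IsCentralSupport V Set.univ

/-- `V` is the least upper bound of the family `T` within the collection `P` (ordered by `⊆`). -/
def IsLUBIn {α : Type*} (P T : Set (Set α)) (V : Set α) : Prop :=
  V ∈ P ∧ (∀ W ∈ T, W ⊆ V) ∧ ∀ U ∈ P, (∀ W ∈ T, W ⊆ U) → V ⊆ U

/-- Two sets are orthogonal if their pointwise products vanish. -/
def OrthogSets [Mul A] [Zero A] (V W : Set A) : Prop :=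
  ∀ v ∈ V, ∀ w ∈ W, v * w = 0

/-- `A` is a C*-factor: it has no nonzero proper two-sided ideals `I`, `J` with `I·J = {0}`. -/
def IsCStarFactor (A : Type*) [NonUnitalRing A] : Prop :=
  ¬∃ I J : TwoSidedIdeal A, I ≠ ⊥ ∧ I ≠ ⊤ ∧ J ≠ ⊥ ∧ J ≠ ⊤ ∧
    {x : A | ∃ a ∈ I, ∃ b ∈ J, x = a * b} = {0}

section RingLemmas

variable {A : Type*} [NonUnitalCStarAlgebra A]

/-- A C*-factor is prime: `x A y = 0` forces `x = 0` or `y = 0`. -/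
theorem IsCStarFactor.eq_zero_or_eq_zero (hfac : IsCStarFactor A) {x y : A}
    (h : ∀ a, x * a * y = 0) : x = 0 ∨ y = 0 := by
  by_contra! hne
  obtain ⟨hx, hy⟩ := hne
  let I : TwoSidedIdeal A := .mk' {z | ∀ a, z * a * y = 0} (by simp)
    (fun hu hv a => by simp [add_mul, hu a, hv a]) (fun hu a => by simp [hu a])
    (fun {b u} hu a => by
      have := hu a
      simp only [mul_assoc] at this ⊢
      rw [this, mul_zero])
    (fun {u b} hu a => by
      have := hu (b * a)
      simp only [mul_assoc] at this ⊢
      rw [this])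
  have mem_I (z : A) : z ∈ I ↔ ∀ a, z * a * y = 0 := TwoSidedIdeal.mem_mk' ..
  let J : TwoSidedIdeal A := .mk' {w | ∀ z ∈ I, ∀ a, z * a * w = 0} (by simp)
    (fun hu hv z hz a => by simp [mul_add, hu z hz a, hv z hz a])
    (fun hu z hz a => by simp [hu z hz a])
    (fun {b u} hu z hz a => by
      have := hu z hz (a * b)
      simp only [mul_assoc] at this ⊢
      rw [this])
    (fun {u b} hu z hz a => by
      have := hu z hz a
      rw [← mul_assoc, this, zero_mul])
  have mem_J (w : A) : w ∈ J ↔ ∀ z ∈ I, ∀ a, z * a * w = 0 := TwoSidedIdeal.mem_mk' ..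
  have hxI : x ∈ I := (mem_I x).2 h
  have hyJ : y ∈ J := (mem_J y).2 fun z hz => (mem_I z).1 hz
  have hIJ : ∀ z ∈ I, ∀ w ∈ J, z * w = 0 := fun z hz w hw => by
    have h1 : z * (star z * z) * w = 0 := (mem_J w).1 hw z hz _
    have h2 : star z * z * w = 0 := by
      rw [← CStarRing.star_mul_self_eq_zero_iff]
      simp only [star_mul, star_star, mul_assoc] at h1 ⊢
      simp [h1]
    rw [← CStarRing.star_mul_self_eq_zero_iff]
    simp only [star_mul, mul_assoc] at h2 ⊢
    simp [h2]
  refine hfac ⟨I, J, ?_, ?_, ?_, ?_, ?_⟩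
  · rintro hI
    rw [hI, TwoSidedIdeal.mem_bot] at hxI
    exact hx hxI
  · intro hI
    exact hy (CStarRing.star_mul_self_eq_zero_iff y |>.1 <|
      hIJ _ (hI ▸ TwoSidedIdeal.mem_top A) y hyJ)
  · rintro hJ
    rw [hJ, TwoSidedIdeal.mem_bot] at hyJ
    exact hy hyJ
  · intro hJ
    exact hx (CStarRing.mul_star_self_eq_zero_iff x |>.1 <|
      hIJ x hxI _ (hJ ▸ TwoSidedIdeal.mem_top A))
  · ext z
    constructor
    · rintro ⟨a, ha, b, hb, rfl⟩
      exact hIJ a ha b hb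
    · rintro rfl
      exact ⟨x, hxI, 0, J.zero_mem, by simp⟩

theorem mul_star_mul_self_eq_smul {c : A} {t : ℝ}
    (h : c * star c * (c * star c) = t • (c * star c)) : c * star c * c = t • c := by
  rw [← sub_eq_zero, ← CStarRing.mul_star_self_eq_zero_iff]
  have e : (c * star c * c - t • c) * star (c * star c * c - t • c) =
      c * star c * (c * star c) * (c * star c) - t • (c * star c * (c * star c))
        - (t • (c * star c * (c * star c)) - t • t • (c * star c)) := by
    simp only [star_sub, star_mul, star_star, star_smul, star_trivial, sub_mul, mul_sub,
      smul_sub, smul_mul_assoc, mul_smul_comm, mul_assoc]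
  rw [e, h, smul_mul_assoc, h]
  simp

theorem zero_mem_Ann (S : Set A) : (0 : A) ∈ Ann S := fun s _ => by simp

theorem Ann_zero : Ann ({0} : Set A) = Set.univ := by
  ext a
  simp [Ann]

theorem dAnn_univ : dAnn (Set.univ : Set A) = {0} := by
  refine Set.eq_singleton_iff_unique_mem.2 ⟨by simp [dAnn], fun a ha => ?_⟩
  have h := ha (star a) trivial (star a) trivial
  rw [← two_smul ℂ, smul_eq_zero_iff_right two_ne_zero] at h
  rw [← CStarRing.star_mul_self_eq_zero_iff, ← CStarRing.star_mul_self_eq_zero_iff, star_mul,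
    star_star, ← mul_assoc, h, zero_mul]

end RingLemmas

section Order

variable {A : Type*} [NonUnitalCStarAlgebra A] [PartialOrder A] [StarOrderedRing A]
  {S : Set A}

theorem mul_eq_zero_of_anticomm_of_nonneg {a s : A} (hs : 0 ≤ s) (h : a * s + s * a = 0) :
    a * s = 0 ∧ s * a = 0 := by
  have hc : Commute (s * s) a := by
    have h' : a * s = -(s * a) := eq_neg_of_add_eq_zero_left h
    change s * s * a = a * (s * s)
    rw [← mul_assoc a, h', neg_mul, mul_assoc s a, h', mul_neg, neg_neg, mul_assoc]
  have hc' : s * a = a * s := by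
    have := hc.cfcₙ_nnreal NNReal.sqrt
    rw [← CFC.sqrt, CFC.sqrt_mul_self s hs] at this
    exact this
  rw [hc', ← two_smul ℂ, smul_eq_zero_iff_right two_ne_zero] at h
  exact ⟨h, hc'.trans h⟩

theorem mem_Ann_iff (hS : ∀ s ∈ S, 0 ≤ s) {a : A} :
    a ∈ Ann S ↔ ∀ s ∈ S, a * s = 0 ∧ s * a = 0 :=
  ⟨fun h s hs => mul_eq_zero_of_anticomm_of_nonneg (hS s hs) (h s hs),
    fun h s hs => by rw [(h s hs).1, (h s hs).2, add_zero]⟩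

theorem star_mem_Ann (hS : ∀ s ∈ S, 0 ≤ s) {a : A} (ha : a ∈ Ann S) : star a ∈ Ann S := by
  refine (mem_Ann_iff hS).2 fun s hs => ?_
  have h := (mem_Ann_iff hS).1 ha s hs
  have hs' : star s = s := (hS s hs).isSelfAdjoint
  constructor
  · simpa [hs'] using congrArg star h.2
  · simpa [hs'] using congrArg star h.1

theorem mul_mul_mem_Ann (hS : ∀ s ∈ S, 0 ≤ s) {x y : A} (hx : x ∈ Ann S) (hy : y ∈ Ann S)
    (a : A) : x * a * y ∈ Ann S := by
  refine (mem_Ann_iff hS).2 fun s hs => ?_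
  have h1 := (mem_Ann_iff hS).1 hx s hs
  have h2 := (mem_Ann_iff hS).1 hy s hs
  constructor
  · rw [mul_assoc, h2.1, mul_zero]
  · rw [mul_assoc, ← mul_assoc, h1.2, zero_mul]

theorem mul_mem_Ann (hS : ∀ s ∈ S, 0 ≤ s) {x y : A} (hx : x ∈ Ann S) (hy : y ∈ Ann S) :
    x * y ∈ Ann S := by
  refine (mem_Ann_iff hS).2 fun s hs => ?_
  have h1 := (mem_Ann_iff hS).1 hx s hs
  have h2 := (mem_Ann_iff hS).1 hy s hs
  constructor
  · rw [mul_assoc, h2.1, mul_zero]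
  · rw [← mul_assoc, h1.2, zero_mul]

theorem mul_eq_zero_of_mem_Ann_Ann (hS : ∀ s ∈ S, 0 ≤ s) {x y : A} (hx : x ∈ Ann (Ann S))
    (hy : y ∈ Ann S) : x * y = 0 ∧ y * x = 0 := by
  have h1 := (mul_eq_zero_of_anticomm_of_nonneg (mul_star_self_nonneg y)
    (hx _ (mul_mem_Ann hS hy (star_mem_Ann hS hy)))).1
  have h2 := (mul_eq_zero_of_anticomm_of_nonneg (star_mul_self_nonneg y)
    (hx _ (mul_mem_Ann hS (star_mem_Ann hS hy) hy))).2
  constructor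
  · rw [← CStarRing.mul_star_self_eq_zero_iff]
    rw [star_mul, mul_assoc, ← mul_assoc y, ← mul_assoc, h1, zero_mul]
  · rw [← CStarRing.star_mul_self_eq_zero_iff]
    rw [star_mul, mul_assoc, ← mul_assoc (star y), h2, mul_zero]

theorem mem_Ann_Ann_iff (hS : ∀ s ∈ S, 0 ≤ s) {x : A} :
    x ∈ Ann (Ann S) ↔ ∀ y ∈ Ann S, x * y = 0 ∧ y * x = 0 :=
  ⟨fun hx _ hy => mul_eq_zero_of_mem_Ann_Ann hS hx hy,
    fun h y hy => by rw [(h y hy).1, (h y hy).2, add_zero]⟩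

theorem star_mem_Ann_Ann (hS : ∀ s ∈ S, 0 ≤ s) {x : A} (hx : x ∈ Ann (Ann S)) :
    star x ∈ Ann (Ann S) := by
  refine (mem_Ann_Ann_iff hS).2 fun y hy => ?_
  have h := (mem_Ann_Ann_iff hS).1 hx _ (star_mem_Ann hS hy)
  constructor
  · simpa using congrArg star h.2
  · simpa using congrArg star h.1

theorem mul_mul_mem_Ann_Ann (hS : ∀ s ∈ S, 0 ≤ s) {x y : A} (hx : x ∈ Ann (Ann S))
    (hy : y ∈ Ann (Ann S)) (a : A) : x * a * y ∈ Ann (Ann S) := by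
  refine (mem_Ann_Ann_iff hS).2 fun b hb => ?_
  have h1 := (mem_Ann_Ann_iff hS).1 hx b hb
  have h2 := (mem_Ann_Ann_iff hS).1 hy b hb
  constructor
  · rw [mul_assoc, h2.1, mul_zero]
  · rw [mul_assoc, ← mul_assoc, h1.2, zero_mul]

theorem Ann_univ : Ann (Set.univ : Set A) = {0} := by
  refine Set.eq_singleton_iff_unique_mem.2 ⟨zero_mem_Ann _, fun a ha => ?_⟩
  have h := (mul_eq_zero_of_anticomm_of_nonneg (star_mul_self_nonneg a) (ha _ trivial)).1
  rw [← CStarRing.star_mul_self_eq_zero_iff, ← CStarRing.star_mul_self_eq_zero_iff]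
  simp only [star_mul, star_star, mul_assoc] at h ⊢
  simp [h]

theorem isCentralAnn_zero : IsCentralAnn ({0} : Set A) :=
  ⟨{0}, by simp, by rw [Ann_zero, Ann_univ], by
    rw [Ann_zero, dAnn_univ, Set.inter_eq_right, Set.singleton_subset_iff]
    simp [dAnn]⟩

/-- In a C*-factor, the only nonzero central annihilator is the whole algebra. -/
theorem IsCentralAnn.eq_univ (hfac : IsCStarFactor A) {W : Set A} (hW : IsCentralAnn W)
    {x : A} (hx : x ∈ W) (hx0 : x ≠ 0) : W = Set.univ := by
  obtain ⟨S, hS, rfl, hd⟩ := hW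
  suffices h : Ann S = {0} by rw [h, Ann_zero]
  refine Set.eq_singleton_iff_unique_mem.2 ⟨zero_mem_Ann _, fun y hy => ?_⟩
  refine (hfac.eq_zero_or_eq_zero fun a => ?_).resolve_left hx0
  have hmem : x * a * y ∈ dAnn (Ann (Ann S)) ∩ dAnn (Ann S) := by
    constructor
    · have (u v : A) (hv : v ∈ Ann (Ann S)) : u * (x * a * y) * v = 0 := by
        rw [mul_assoc, mul_assoc (x * a), (mul_eq_zero_of_mem_Ann_Ann hS hv hy).2, mul_zero,
          mul_zero]
      exact fun u hu v hv => by rw [this u v hv, this v u hu, add_zero]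
    · have (u v : A) (hu : u ∈ Ann S) : u * (x * a * y) * v = 0 := by
        rw [mul_assoc x, ← mul_assoc u, (mul_eq_zero_of_mem_Ann_Ann hS hx hu).2, zero_mul,
          zero_mul]
      exact fun u hu v hv => by rw [this u v hu, this v u hv, add_zero]
  rwa [hd] at hmem

/-- In a C*-factor, an Abelian annihilator has no zero divisors. -/
theorem IsAbelianAnn.eq_zero_or_eq_zero (hfac : IsCStarFactor A) {V : Set A}
    (hV : IsAbelianAnn V) {x y : A} (hx : x ∈ V) (hy : y ∈ V) (h : x * y = 0) :
    x = 0 ∨ y = 0 := by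
  obtain ⟨⟨S, hS, rfl⟩, hcomm⟩ := hV
  by_cases hy0 : y = 0
  · exact .inr hy0
  left
  have := (hfac.eq_zero_or_eq_zero (x := x * star x) (y := y) fun a => ?_).resolve_right hy0
  · exact (CStarRing.mul_star_self_eq_zero_iff x).1 this
  · have hu := star_mem_Ann_Ann hS hx
    rw [mul_assoc, mul_assoc, ← mul_assoc (star x), hcomm x hx _ (mul_mul_mem_Ann_Ann hS hu hy a),
      mul_assoc, hcomm y hy x hx, h, mul_zero]

/-- In a C*-factor, a self-adjoint element of an Abelian annihilator is a multiple of
a projection. -/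
theorem IsAbelianAnn.exists_mul_self_eq_smul (hfac : IsCStarFactor A) {V : Set A}
    (hV : IsAbelianAnn V) {h : A} (hh : h ∈ V) (hsa : IsSelfAdjoint h) :
    ∃ t : ℝ, h * h = t • h := by
  have key : ∀ l ∈ quasispectrum ℝ h, ∀ m ∈ quasispectrum ℝ h, l ≠ 0 → m ≠ 0 → ¬ l < m := by
    intro l hl m hm hl0 hm0 hlm
    obtain ⟨r, hlr, hrm⟩ := exists_between hlm
    let f : ℝ → ℝ := fun x => x * max (r - x) 0
    let g : ℝ → ℝ := fun x => x * max (x - r) 0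
    have hf : Continuous f := by fun_prop
    have hg : Continuous g := by fun_prop
    have mem (f : ℝ → ℝ) (hf : Continuous f) (hf0 : f 0 = 0) :
        cfcₙ (fun x => x * f x * x) h ∈ V := by
      rw [cfcₙ_mul (fun x => x * f x) (fun x => x) h (by fun_prop) (by simp) (by fun_prop) rfl,
        cfcₙ_mul (fun x => x) f h (by fun_prop) rfl (by fun_prop) hf0, cfcₙ_id' ℝ h]
      obtain ⟨⟨S, hS, rfl⟩, -⟩ := hV
      exact mul_mul_mem_Ann_Ann hS hh hh _
    have nonzero (f : ℝ → ℝ) (hf : Continuous f) (p : ℝ) (hp : p ∈ quasispectrum ℝ h)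
        (hp0 : p ≠ 0) (hfp : f p ≠ 0) : cfcₙ (fun x => x * f x * x) h ≠ 0 := by
      intro h0
      have hmap := cfcₙ_map_quasispectrum (fun x => x * f x * x) h (by fun_prop) (by simp)
      rw [h0, CFC.quasispectrum_zero_eq] at hmap
      have hmem : p * f p * p ∈ ({0} : Set ℝ) := by
        rw [hmap]
        exact ⟨p, hp, rfl⟩
      exact mul_ne_zero (mul_ne_zero hp0 hfp) hp0 hmem
    refine (hV.eq_zero_or_eq_zero hfac (mem f hf (by simp [f])) (mem g hg (by simp [g])) ?_).elim
      (nonzero f hf l hl hl0 ?_) (nonzero g hg m hm hm0 ?_)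
    · rw [← cfcₙ_mul _ _ h (by fun_prop) (by simp) (by fun_prop) (by simp)]
      have : (fun x => x * f x * x * (x * g x * x)) = fun _ : ℝ => (0 : ℝ) := by
        ext x
        rcases le_total x r with hx | hx
        · simp [g, hx]
        · simp [f, hx]
      rw [this, cfcₙ_const_zero]
    · simp only [f, ne_eq, mul_eq_zero, hl0, false_or]
      exact (lt_max_of_lt_left (sub_pos.2 hlr)).ne'
    · simp only [g, ne_eq, mul_eq_zero, hm0, false_or]
      exact (lt_max_of_lt_left (sub_pos.2 hrm)).ne'
  obtain ⟨t, ht⟩ : ∃ t : ℝ, ∀ l ∈ quasispectrum ℝ h, l * l = t * l := by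
    by_cases hex : ∃ t ∈ quasispectrum ℝ h, t ≠ 0
    · obtain ⟨t, ht, ht0⟩ := hex
      refine ⟨t, fun l hl => ?_⟩
      by_cases hl0 : l = 0
      · simp [hl0]
      · rw [le_antisymm (not_lt.1 (key t ht l hl ht0 hl0)) (not_lt.1 (key l hl t ht hl0 ht0))]
    · push Not at hex
      exact ⟨0, fun l hl => by simp [hex l hl]⟩
  refine ⟨t, ?_⟩
  have e1 : h * h = cfcₙ (fun x : ℝ => x * x) h := by
    rw [cfcₙ_mul (fun x => x) (fun x => x) h (by fun_prop) rfl (by fun_prop) rfl, cfcₙ_id' ℝ h]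
  have e2 : t • h = cfcₙ (fun x : ℝ => t * x) h := by
    rw [cfcₙ_const_mul t (fun x => x) h (by fun_prop) rfl, cfcₙ_id' ℝ h]
  rw [e1, e2]
  exact cfcₙ_congr ht

/-- If `k ≥ 0` is a multiple of a projection, then the annihilator generated by `k` is contained
in the corner cut out by `k`. -/
theorem smul_eq_of_mem_Ann_Ann_singleton {k x : A} {t : ℝ} (hk : 0 ≤ k) (hkk : k * k = t • k)
    (hx : x ∈ Ann (Ann {k})) : x * k = t • x ∧ k * x = t • x := by
  have hS : ∀ s ∈ ({k} : Set A), 0 ≤ s := by simpa using hk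
  have hks : star k = k := hk.isSelfAdjoint
  have right {x : A} (hx : x ∈ Ann (Ann {k})) : x * k = t • x := by
    set w := x * k - t • x with hw
    have hwk : w * k = 0 := by
      rw [hw, sub_mul, mul_assoc, hkk, mul_smul_comm, smul_mul_assoc, sub_self]
    have hkw : k * star w = 0 := by simpa [hks] using congrArg star hwk
    have hy : star w * w ∈ Ann {k} := (mem_Ann_iff hS).2 fun s hs => by
      rw [Set.mem_singleton_iff.1 hs]
      exact ⟨by rw [mul_assoc, hwk, mul_zero], by rw [← mul_assoc, hkw, zero_mul]⟩
    have hxy := (mul_eq_zero_of_mem_Ann_Ann hS hx hy).1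
    have hwy : w * (star w * w) = 0 := by
      rw [hw, sub_mul, ← hw, mul_assoc x k, ← mul_assoc k, hkw, zero_mul, mul_zero,
        smul_mul_assoc, hxy, smul_zero, sub_zero]
    have : star w * w = 0 := by
      rw [← CStarRing.star_mul_self_eq_zero_iff, star_mul, star_star, mul_assoc, hwy, mul_zero]
    exact sub_eq_zero.1 ((CStarRing.star_mul_self_eq_zero_iff w).1 this)
  refine ⟨right hx, ?_⟩
  simpa [hks] using congrArg star (right (star_mem_Ann_Ann hS hx))

/-- In a C*-factor with a nonzero Abelian annihilator, every nonzero annihilator contains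
a nonzero Abelian annihilator. -/
theorem IsAbelianAnn.exists_subset_Ann (hfac : IsCStarFactor A) {V : Set A}
    (hV : IsAbelianAnn V) {v b : A} (hv : v ∈ V) (hv0 : v ≠ 0) (hS : ∀ s ∈ S, 0 ≤ s)
    (hb : b ∈ Ann S) (hb0 : b ≠ 0) :
    ∃ P, IsAbelianAnn P ∧ P ⊆ Ann S ∧ ∃ k ∈ P, k * k ≠ 0 := by
  obtain ⟨a, ha⟩ : ∃ a, v * a * b ≠ 0 := by
    by_contra! h
    exact (hfac.eq_zero_or_eq_zero h).elim hv0 hb0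
  set c := v * a * b with hc
  have hmem (x : A) : c * x * star c ∈ V := by
    obtain ⟨⟨R, hR, rfl⟩, -⟩ := hV
    have := mul_mul_mem_Ann_Ann hR hv (star_mem_Ann_Ann hR hv) (a * b * x * (star b * star a))
    simpa only [hc, star_mul, mul_assoc] using this
  have hmem' : c * star c ∈ V := by
    obtain ⟨⟨R, hR, rfl⟩, -⟩ := hV
    have := mul_mul_mem_Ann_Ann hR hv (star_mem_Ann_Ann hR hv) (a * b * (star b * star a))
    simpa only [hc, star_mul, mul_assoc] using this
  obtain ⟨t, ht⟩ := hV.exists_mul_self_eq_smul hfac hmem' (.mul_star_self c)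
  have htc := mul_star_mul_self_eq_smul ht
  have ht0 : t ≠ 0 := by
    rintro rfl
    rw [zero_smul] at ht
    have h := hV.eq_zero_or_eq_zero hfac hmem' hmem' ht
    simp [CStarRing.mul_star_self_eq_zero_iff, ha] at h
  set k := star c * c with hk
  have hk0 : 0 ≤ k := star_mul_self_nonneg c
  have hkne : k ≠ 0 := (CStarRing.star_mul_self_eq_zero_iff c).not.2 ha
  have hkk : k * k = t • k := by
    rw [hk, mul_assoc, ← mul_assoc c, htc, mul_smul_comm]
  have hkS : k ∈ Ann S := by
    refine (mem_Ann_iff hS).2 fun s hs => ?_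
    have h1 := ((mem_Ann_iff hS).1 hb s hs).1
    have h2 := ((mem_Ann_iff hS).1 (star_mem_Ann hS hb) s hs).2
    constructor
    · rw [hk, hc, mul_assoc, mul_assoc (v * a), h1, mul_zero, mul_zero]
    · rw [hk, hc, star_mul, ← mul_assoc s, ← mul_assoc s, h2, zero_mul, zero_mul]
  have hP {x : A} (hx : x ∈ Ann (Ann {k})) := smul_eq_of_mem_Ann_Ann_singleton hk0 hkk hx
  refine ⟨Ann (Ann {k}), ⟨⟨{k}, by simpa using hk0, rfl⟩, ?_⟩, ?_, k, ?_, ?_⟩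
  · intro x hx y hy
    have prod {x y : A} (hx : x ∈ Ann (Ann {k})) (hy : y ∈ Ann (Ann {k})) :
        t • t • t • (x * y) = star c * ((c * x * star c) * (c * y * star c)) * c := by
      have e : star c * ((c * x * star c) * (c * y * star c)) * c = k * x * (k * (y * k)) := by
        simp only [hk, mul_assoc]
      rw [e, (hP hx).2, (hP hy).1, mul_smul_comm, (hP hy).2, smul_mul_assoc, mul_smul_comm,
        mul_smul_comm]
    have h : t • t • t • (x * y) = t • t • t • (y * x) := by
      rw [prod hx hy, prod hy hx, hV.2 _ (hmem x) _ (hmem y)]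
    simpa [smul_right_inj ht0] using h
  · intro x hx
    refine (mem_Ann_iff hS).2 fun s hs => ?_
    have h := (mem_Ann_iff hS).1 hkS s hs
    constructor
    · rw [← smul_eq_zero_iff_right ht0, ← smul_mul_assoc, ← (hP hx).1, mul_assoc, h.1, mul_zero]
    · rw [← smul_eq_zero_iff_right ht0, ← mul_smul_comm, ← (hP hx).2, ← mul_assoc, h.2, zero_mul]
  · exact fun y hy => by rw [add_comm]; exact hy k rfl
  · rw [hkk]
    exact smul_ne_zero ht0 hkne

end Order

/-- A C*-factor of von Neumann type I is of type `I_n` for some cardinal `n`: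
there is a family of pairwise orthogonal Abelian annihilators, each with central support `A`,
whose supremum in `𝒫` is `A`. -/
theorem stmt_17 {A : Type*} [NonUnitalCStarAlgebra A] [PartialOrder A] [StarOrderedRing A]
    (hfac : IsCStarFactor A) (hI : VonNeumannTypeI A) :
    ∃ T : Set (Set A),
      (∀ P ∈ T, IsAbelianAnn P ∧ IsCentralSupport P Set.univ) ∧
      (∀ P ∈ T, ∀ Q ∈ T, P ≠ Q → OrthogSets P Q) ∧
      IsLUBIn (PAnn A) T Set.univ := by
  obtain ⟨V, hV, hcV⟩ := hI
  let C : Set (Set (Set A)) := {T | (∀ P ∈ T, IsAbelianAnn P ∧ ∃ x ∈ P, x ≠ 0) ∧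
    ∀ P ∈ T, ∀ Q ∈ T, P ≠ Q → OrthogSets P Q}
  obtain ⟨T, hT⟩ : ∃ T, Maximal (· ∈ C) T := by
    refine zorn_subset C fun c hcC hc => ⟨⋃₀ c, ⟨?_, ?_⟩, fun s hs => Set.subset_sUnion_of_mem hs⟩
    · rintro P ⟨s, hs, hP⟩
      exact (hcC hs).1 P hP
    · rintro P ⟨s, hs, hP⟩ Q ⟨s', hs', hQ⟩ hPQ
      rcases hc.total hs hs' with h | h
      · exact (hcC hs').2 P (h hP) Q hQ hPQ
      · exact (hcC hs).2 P hP Q (h hQ) hPQ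
  refine ⟨T, fun P hP => ?_, hT.prop.2, ?_, fun _ _ => Set.subset_univ _, ?_⟩
  · obtain ⟨hPa, x, hx, hx0⟩ := hT.prop.1 P hP
    exact ⟨hPa, hcV.1, Set.subset_univ _,
      fun W hW hPW => (hW.eq_univ hfac (hPW hx) hx0).ge⟩
  · obtain ⟨S, hS, h, -⟩ := hcV.1
    exact ⟨S, hS, h⟩
  · rintro _ ⟨S, hS, rfl⟩ hU
    suffices h : Ann S = {0} by rw [h, Ann_zero]
    refine Set.eq_singleton_iff_unique_mem.2 ⟨zero_mem_Ann _, fun b hb => ?_⟩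
    by_contra hb0
    obtain ⟨v, hv, hv0⟩ : ∃ v ∈ V, v ≠ 0 := by
      by_contra! h
      exact hb0 (hcV.2.2 _ isCentralAnn_zero h (Set.mem_univ b))
    obtain ⟨P, hPa, hPS, k, hkP, hkk⟩ := hV.exists_subset_Ann hfac hv hv0 hS hb hb0
    have horth {Q : Set A} (hQ : Q ∈ T) {x y : A} (hx : x ∈ Q) (hy : y ∈ P) :=
      mul_eq_zero_of_mem_Ann_Ann hS (hU Q hQ hx) (hPS hy)
    have hins : insert P T ∈ C := by
      constructor
      · rintro Q (rfl | hQ)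
        · exact ⟨hPa, k, hkP, by rintro rfl; simp at hkk⟩
        · exact hT.prop.1 Q hQ
      · rintro Q (rfl | hQ) R (rfl | hR) hne
        · exact absurd rfl hne
        · exact fun x hx y hy => (horth hR hy hx).2
        · exact fun x hx y hy => (horth hQ hx hy).1
        · exact hT.prop.2 Q hQ R hR hne
    have hPT : P ∈ T := hT.le_of_ge hins (Set.subset_insert P T) (Set.mem_insert P T)
    exact hkk (horth hPT hkP hkP).1
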